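/- Let V be a finite set and let f : Finset V → ℝ be normalized, monotone, and submodular. Let K ≥ 1, let S⋆ ⊆ V satisfy |S⋆| ≤ K, and let S₀ = ∅, S_{i+1} = S_i ∪ {e_i} be a greedy sequence in which each e_i maximizes f(S_i ∪ {e}) over e ∈ V. Then for every i ≥ 0, f(S⋆) − f(S_i) ≤ (1 − 1/K)^i · f(S⋆). -/

import Mathlib

/-- For a submodular set function, the gain from adding a set `T` to `A` is at most the sum of
the marginal gains of the elements of `T`. -/
theorem submodular_union_sub_le_sum {V : Type*} [DecidableEq V] (f : Finset V → ℝ)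
    (hsub : ∀ A B : Finset V, A ⊆ B → ∀ e ∉ B,
      f (insert e B) - f B ≤ f (insert e A) - f A)
    (A T : Finset V) : f (A ∪ T) - f A ≤ ∑ e ∈ T, (f (insert e A) - f A) := by
  induction T using Finset.induction_on with
  | empty => simp
  | insert a T ha ih =>
    rw [Finset.sum_insert ha, Finset.union_insert]
    by_cases haA : a ∈ A
    · rw [Finset.insert_eq_of_mem (Finset.mem_union_left T haA), Finset.insert_eq_of_mem haA]
      linarith
    · have := hsub A (A ∪ T) Finset.subset_union_left a (by simp [haA, ha])
      linarith

/-- For a normalized, monotone, submodular set function `f` and a greedy sequence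
`S₀ = ∅`, `S_{i+1} = S_i ∪ {e_i}` with `e_i` maximizing `f (S_i ∪ {e})`, the optimality
gap with respect to any `Sstar` with `|Sstar| ≤ K` contracts geometrically:
`f Sstar - f (S i) ≤ (1 - 1/K)^i * f Sstar`. -/
theorem greedy_geometric_gap_bound {V : Type*} [Fintype V] [DecidableEq V]
    (f : Finset V → ℝ)
    (hnorm : f ∅ = 0)
    (hmono : ∀ A B : Finset V, A ⊆ B → f A ≤ f B)
    (hsub : ∀ A B : Finset V, A ⊆ B → ∀ e ∉ B,
      f (insert e B) - f B ≤ f (insert e A) - f A)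
    (K : ℕ) (hK : 1 ≤ K)
    (Sstar : Finset V) (hcard : Sstar.card ≤ K)
    (S : ℕ → Finset V)
    (hS0 : S 0 = ∅)
    (hgreedy : ∀ i : ℕ, ∃ e : V, S (i + 1) = insert e (S i) ∧
      ∀ e' : V, f (insert e' (S i)) ≤ f (insert e (S i))) :
    ∀ i : ℕ, f Sstar - f (S i) ≤ (1 - 1 / (K : ℝ)) ^ i * f Sstar := by
  have hKpos : (0 : ℝ) < K := by exact_mod_cast hK
  intro i
  induction i with
  | zero => simp [hS0, hnorm]
  | succ i ih =>
    obtain ⟨e, he, hmax⟩ := hgreedy i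
    have hgap : f Sstar - f (S i) ≤ K * (f (S (i + 1)) - f (S i)) := by
      have hgain : 0 ≤ f (S (i + 1)) - f (S i) :=
        sub_nonneg.2 (hmono _ _ (he ▸ Finset.subset_insert e (S i)))
      calc f Sstar - f (S i)
          ≤ f (S i ∪ Sstar) - f (S i) :=
            sub_le_sub_right (hmono _ _ Finset.subset_union_right) _
        _ ≤ ∑ e' ∈ Sstar, (f (insert e' (S i)) - f (S i)) :=
            submodular_union_sub_le_sum f hsub _ _
        _ ≤ ∑ _e' ∈ Sstar, (f (S (i + 1)) - f (S i)) :=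
            Finset.sum_le_sum fun e' _ => sub_le_sub_right (he ▸ hmax e') _
        _ = Sstar.card * (f (S (i + 1)) - f (S i)) := by
            rw [Finset.sum_const, nsmul_eq_mul]
        _ ≤ K * (f (S (i + 1)) - f (S i)) := by gcongr
    have hratio : 0 ≤ 1 - 1 / (K : ℝ) :=
      sub_nonneg.2 ((div_le_one hKpos).2 (by exact_mod_cast hK))
    calc f Sstar - f (S (i + 1))
        = (f Sstar - f (S i)) - (f (S (i + 1)) - f (S i)) := by ring
      _ ≤ (f Sstar - f (S i)) - (f Sstar - f (S i)) / K :=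
          sub_le_sub_left ((div_le_iff₀' hKpos).2 hgap) _
      _ = (1 - 1 / (K : ℝ)) * (f Sstar - f (S i)) := by ring
      _ ≤ (1 - 1 / (K : ℝ)) * ((1 - 1 / (K : ℝ)) ^ i * f Sstar) :=
          mul_le_mul_of_nonneg_left ih hratio
      _ = (1 - 1 / (K : ℝ)) ^ (i + 1) * f Sstar := by ring
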